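/- arXiv:2201.06345 — 2 statements merged into one kernel-verified Lean document; each statement's English description precedes it below -/
import Mathlib

section
/- For every x > 0 and β ∈ (0,1), the Mittag-Leffler function E_β(-x) satisfies the two-sided bound 1/(1 + Γ(1-β)·x) ≤ E_β(-x) ≤ 1/(1 + x/Γ(1+β)). -/
open Real

/-- The Mittag-Leffler function of order `β`. -/
noncomputable def mittagLeffler (β x : ℝ) : ℝ :=
  ∑' j : ℕ, x ^ j / Real.Gamma (1 + β * j)

open Set Filter Topology MeasureTheory

theorem ml_beta_int {a b t : ℝ} (ha : 0 < a) (hb : 0 < b) (ht : 0 < t) :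
    ∫ s in Ioo 0 t, (t - s) ^ (a - 1) * s ^ (b - 1) =
      t ^ (a + b - 1) * (Gamma a * Gamma b / Gamma (a + b)) := by
  have h := Complex.betaIntegral_scaled (b : ℂ) (a : ℂ) ht
  rw [Complex.betaIntegral_eq_Gamma_mul_div _ _ (by simpa) (by simpa)] at h
  rw [intervalIntegral.integral_of_le ht.le, integral_Ioc_eq_integral_Ioo] at h
  have h2 : ∫ x in Ioo 0 t, (x : ℂ) ^ ((b : ℂ) - 1) * ((t : ℂ) - x) ^ ((a : ℂ) - 1) =
      ∫ x in Ioo 0 t, (((t - x) ^ (a - 1) * x ^ (b - 1) : ℝ) : ℂ) := by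
    apply setIntegral_congr_fun measurableSet_Ioo
    intro x hx
    have h1 : 0 ≤ t - x := by linarith [hx.2]
    simp only
    rw [Complex.ofReal_mul, Complex.ofReal_cpow h1, Complex.ofReal_cpow hx.1.le]
    push_cast
    ring
  rw [h2, integral_complex_ofReal] at h
  have h3 : (t : ℂ) ^ ((b : ℂ) + a - 1) = ((t ^ (a + b - 1) : ℝ) : ℂ) := by
    rw [Complex.ofReal_cpow ht.le]
    push_cast
    congr 1; ring
  rw [h3, ← Complex.ofReal_add, Complex.Gamma_ofReal, Complex.Gamma_ofReal, Complex.Gamma_ofReal,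
    add_comm b a] at h
  norm_cast at h
  rw [h]; ring

theorem ml_beta_integrable {a b t : ℝ} (ha : 0 < a) (hb : 0 < b) (ht : 0 < t) :
    IntegrableOn (fun s => (t - s) ^ (a - 1) * s ^ (b - 1)) (Ioo 0 t) := by
  by_contra hcon
  have h1 := ml_beta_int ha hb ht
  rw [integral_undef hcon] at h1
  have := Gamma_pos_of_pos ha
  have := Gamma_pos_of_pos hb
  have := Gamma_pos_of_pos (add_pos ha hb)
  have : 0 < t ^ (a + b - 1) * (Gamma a * Gamma b / Gamma (a + b)) := by positivity
  linarith

theorem ml_ratio {β z : ℝ} (hβ : 0 < β) (hβ1 : β < 1) (hz : 1 ≤ z) :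
    Gamma z ≤ Gamma (z + β) * (z + β - 1) ^ (-β) := by
  have h0 : 0 < z + β - 1 := by linarith
  have h := Gamma_mul_add_mul_le_rpow_Gamma_mul_rpow_Gamma h0 (by linarith : 0 < z + β)
    hβ (by linarith : 0 < 1 - β) (by ring)
  have e1 : β * (z + β - 1) + (1 - β) * (z + β) = z := by ring
  rw [e1] at h
  have hG := Gamma_pos_of_pos h0
  have e2 : Gamma (z + β) = (z + β - 1) * Gamma (z + β - 1) := by
    rw [← Gamma_add_one h0.ne']; congr 1; ring
  have hG' : 0 < Gamma (z + β) := Gamma_pos_of_pos (by linarith)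
  refine h.trans (le_of_eq ?_)
  have e3 : Gamma (z + β - 1) = Gamma (z + β) * (z + β - 1)⁻¹ := by
    rw [e2]; field_simp
  rw [e3, mul_rpow hG'.le (by positivity), inv_rpow h0.le, rpow_neg h0.le]
  have : Gamma (z + β) ^ β * Gamma (z + β) ^ (1 - β) = Gamma (z + β) := by
    rw [← rpow_add hG']; simp
  calc _ = (Gamma (z + β) ^ β * Gamma (z + β) ^ (1 - β)) * ((z + β - 1) ^ β)⁻¹ := by ring
    _ = _ := by rw [this]

theorem ml_summable {β b : ℝ} (hβ : 0 < β) (hβ1 : β < 1) (hb : 0 < b) (y : ℝ) :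
    Summable (fun j : ℕ => y ^ j / Gamma (b + β * j)) := by
  have hpos : ∀ j : ℕ, 0 < Gamma (b + β * j) := fun j => Gamma_pos_of_pos (by positivity)
  rcases eq_or_ne y 0 with rfl | hy
  · apply summable_of_ne_finset_zero (s := {0})
    intro j hj
    have : j ≠ 0 := by simpa using hj
    simp [this]
  apply summable_of_ratio_test_tendsto_lt_one (l := 0) one_pos
  · exact Eventually.of_forall fun j => div_ne_zero (pow_ne_zero _ hy) (hpos j).ne'
  have hlin : Tendsto (fun j : ℕ => b + β * j + β - 1) atTop atTop := by
    have h1 : Tendsto (fun j : ℕ => β * (j : ℝ)) atTop atTop :=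
      tendsto_natCast_atTop_atTop.const_mul_atTop hβ
    have := tendsto_atTop_add_const_left _ (b + β - 1) h1
    refine this.congr fun j => by ring
  have hlim : Tendsto (fun j : ℕ => |y| * (b + β * j + β - 1) ^ (-β)) atTop (𝓝 0) := by
    have := ((tendsto_rpow_neg_atTop hβ).comp hlin).const_mul |y|
    simpa using this
  refine squeeze_zero' (Eventually.of_forall fun j => by positivity) ?_ hlim
  filter_upwards [hlin.eventually_ge_atTop β] with j hj
  have h := ml_ratio hβ hβ1 (z := b + β * j) (by linarith)
  have e : b + β * ((j + 1 : ℕ) : ℝ) = b + β * j + β := by push_cast; ring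
  have hp := hpos (j + 1)
  have hp0 := hpos j
  rw [e] at hp ⊢
  rw [norm_div, norm_div, norm_pow, norm_pow, Real.norm_of_nonneg hp.le,
    Real.norm_of_nonneg hp0.le, Real.norm_eq_abs]
  have hy' : 0 < |y| := abs_pos.mpr hy
  have : |y| ^ (j + 1) / Gamma (b + β * j + β) / (|y| ^ j / Gamma (b + β * j)) =
      |y| * (Gamma (b + β * j) / Gamma (b + β * j + β)) := by
    field_simp
    rw [pow_succ]
  rw [this]
  gcongr
  rw [div_le_iff₀ hp]
  linarith

noncomputable def mlW (β b y : ℝ) : ℝ := ∑' j : ℕ, (-y) ^ j / Gamma (b + β * j)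

theorem mlW_rec {β b : ℝ} (hβ : 0 < β) (hβ1 : β < 1) (hb : 0 < b) (y : ℝ) :
    mlW β b y = 1 / Gamma b - y * mlW β (b + β) y := by
  unfold mlW
  rw [(ml_summable hβ hβ1 hb (-y)).tsum_eq_zero_add, ← tsum_mul_left, sub_eq_add_neg, ← tsum_neg]
  congr 1
  · simp
  · congr 1; ext j
    have e : b + β * ((j + 1 : ℕ) : ℝ) = b + β + β * j := by push_cast; ring
    rw [e]; ring

theorem mlW_zero {β b : ℝ} (hβ : 0 < β) (hβ1 : β < 1) (hb : 0 < b) :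
    mlW β b 0 = 1 / Gamma b := by
  rw [mlW_rec hβ hβ1 hb]; simp

theorem mlW_cont {β b : ℝ} (hβ : 0 < β) (hβ1 : β < 1) (hb : 0 < b) :
    Continuous (mlW β b) := by
  rw [continuous_iff_continuousAt]
  intro y0
  have : ContinuousOn (mlW β b) (Icc (y0 - 1) (y0 + 1)) := by
    apply continuousOn_tsum (u := fun j : ℕ => (|y0| + 1) ^ j / Gamma (b + β * j))
    · intro j; fun_prop
    · exact ml_summable hβ hβ1 hb _
    · intro j y hy
      have hp : 0 < Gamma (b + β * j) := Gamma_pos_of_pos (by positivity)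
      rw [norm_div, norm_pow, norm_neg, Real.norm_of_nonneg hp.le, Real.norm_eq_abs]
      gcongr
      rw [abs_le]
      constructor <;> linarith [hy.1, hy.2, neg_abs_le y0, le_abs_self y0]
  exact this.continuousAt (Icc_mem_nhds (by linarith) (by linarith))

theorem mlW_conv_integrable {β a b t : ℝ} (hβ : 0 < β) (hβ1 : β < 1) (ha : 0 < a) (hb : 0 < b)
    (ht : 0 < t) :
    IntegrableOn (fun s => (t - s) ^ (a - 1) * (s ^ (b - 1) * mlW β b (s ^ β))) (Ioo 0 t) := by
  have h := ml_beta_integrable ha hb ht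
  rw [← integrableOn_Icc_iff_integrableOn_Ioo] at h
  have h2 : ContinuousOn (fun s : ℝ => mlW β b (s ^ β)) (Icc 0 t) := by
    apply Continuous.continuousOn
    exact (mlW_cont hβ hβ1 hb).comp (continuous_id.rpow_const fun _ => Or.inr hβ.le)
  have h3 := h.mul_continuousOn h2 isCompact_Icc
  rw [integrableOn_Icc_iff_integrableOn_Ioo] at h3
  refine h3.congr_fun (fun s _ => ?_) measurableSet_Ioo
  simp only; ring

theorem mlW_conv {β a b t : ℝ} (hβ : 0 < β) (hβ1 : β < 1) (ha : 0 < a) (hb : 0 < b)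
    (ht : 0 < t) :
    ∫ s in Ioo 0 t, (t - s) ^ (a - 1) * (s ^ (b - 1) * mlW β b (s ^ β)) =
      Gamma a * (t ^ (a + b - 1) * mlW β (a + b) (t ^ β)) := by
  have hbj : ∀ j : ℕ, 0 < b + β * j := fun j => by positivity
  have hG : ∀ j : ℕ, 0 < Gamma (b + β * j) := fun j => Gamma_pos_of_pos (hbj j)
  have hGab : ∀ j : ℕ, 0 < Gamma (a + b + β * j) := fun j => Gamma_pos_of_pos (by positivity)
  have hGa := Gamma_pos_of_pos ha
  let P : ℕ → ℝ → ℝ := fun j s =>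
    ((-1) ^ j / Gamma (b + β * j)) * ((t - s) ^ (a - 1) * s ^ (b + β * j - 1))
  have hPint : ∀ j, IntegrableOn (P j) (Ioo 0 t) := fun j =>
    (ml_beta_integrable ha (hbj j) ht).const_mul _
  have hpow : ∀ j : ℕ, t ^ (a + (b + β * j) - 1) = t ^ (a + b - 1) * (t ^ β) ^ j := by
    intro j
    rw [← rpow_natCast, ← rpow_mul ht.le, ← rpow_add ht]; congr 1; ring
  have hval : ∀ j, ∫ s in Ioo 0 t, P j s =
      Gamma a * (t ^ (a + b - 1) * ((-t ^ β) ^ j / Gamma (a + b + β * j))) := by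
    intro j
    simp only [P]
    rw [integral_const_mul, ml_beta_int ha (hbj j) ht, hpow, neg_pow (t ^ β), ← add_assoc]
    have := (hG j).ne'
    field_simp
  have hnorm : ∀ j, ∫ s in Ioo 0 t, ‖P j s‖ =
      Gamma a * (t ^ (a + b - 1) * ((t ^ β) ^ j / Gamma (a + b + β * j))) := by
    intro j
    have : ∫ s in Ioo 0 t, ‖P j s‖ = ∫ s in Ioo 0 t,
        (1 / Gamma (b + β * j)) * ((t - s) ^ (a - 1) * s ^ (b + β * j - 1)) := by
      apply setIntegral_congr_fun measurableSet_Ioo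
      intro s hs
      have h1 : 0 < t - s := by linarith [hs.2]
      have h2 : 0 < s := hs.1
      have h3 : 0 ≤ (t - s) ^ (a - 1) * s ^ (b + β * j - 1) := by positivity
      simp only [P]
      rw [norm_mul, norm_div, norm_pow, norm_neg, norm_one, one_pow,
        Real.norm_of_nonneg (hG j).le, Real.norm_of_nonneg h3]
    rw [this, integral_const_mul, ml_beta_int ha (hbj j) ht, hpow, ← add_assoc]
    have := (hG j).ne'
    field_simp
  have hs := hasSum_integral_of_summable_integral_norm (μ := volume.restrict (Ioo 0 t)) hPint (by
    simp_rw [hnorm]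
    exact ((ml_summable hβ hβ1 (add_pos ha hb) (t ^ β)).mul_left _).mul_left _)
  have hs2 := hs.tsum_eq
  simp_rw [hval] at hs2
  rw [tsum_mul_left, tsum_mul_left] at hs2
  unfold mlW
  rw [hs2]
  apply setIntegral_congr_fun measurableSet_Ioo
  intro s hs
  simp only
  rw [← tsum_mul_left, ← tsum_mul_left]
  congr 1; ext j
  simp only [P]
  have : s ^ (b + β * j - 1) = s ^ (b - 1) * (s ^ β) ^ j := by
    have hs0 : 0 < s := hs.1
    rw [← rpow_natCast, ← rpow_mul hs0.le, ← rpow_add hs0]; congr 1; ring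
  rw [this, neg_pow (s ^ β)]; ring

theorem ml_kernel_int {a t t0 : ℝ} (ha : 0 < a) (h : t < t0) :
    ∫ s in Ioo t t0, (t0 - s) ^ (a - 1) = (t0 - t) ^ a / a := by
  rw [← integral_Ioc_eq_integral_Ioo, ← intervalIntegral.integral_of_le h.le,
    intervalIntegral.integral_comp_sub_left (fun s => s ^ (a - 1)) t0,
    integral_rpow (Or.inl (by linarith))]
  simp [zero_rpow ha.ne']

theorem ml_kernel_integrable {a t t0 : ℝ} (ha : 0 < a) (h : t < t0) :
    IntegrableOn (fun s => (t0 - s) ^ (a - 1)) (Ioo t t0) := by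
  by_contra hcon
  have h1 := ml_kernel_int ha h
  rw [integral_undef hcon] at h1
  have h2 : 0 < t0 - t := by linarith
  have : 0 < (t0 - t) ^ a / a := by positivity
  linarith

/-- Volterra equation for `v s = s ^ (β - 1) * mlW β β (s ^ β)`. -/
theorem ml_volterra {β t : ℝ} (hβ : 0 < β) (hβ1 : β < 1) (ht : 0 < t) :
    ∫ s in Ioo 0 t, (t - s) ^ (β - 1) * (s ^ (β - 1) * mlW β β (s ^ β)) =
      t ^ (β - 1) - Gamma β * (t ^ (β - 1) * mlW β β (t ^ β)) := by
  rw [mlW_conv hβ hβ1 hβ hβ ht, mlW_rec hβ hβ1 hβ (t ^ β)]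
  have h : t ^ (β + β - 1) = t ^ (β - 1) * t ^ β := by
    rw [← rpow_add ht]; congr 1; ring
  have := (Gamma_pos_of_pos hβ).ne'
  rw [h]; field_simp; ring

theorem mlW_pos {β t : ℝ} (hβ : 0 < β) (hβ1 : β < 1) (ht : 0 ≤ t) :
    0 < mlW β β (t ^ β) := by
  by_contra hcon
  have hG := Gamma_pos_of_pos hβ
  have hWc : Continuous (fun s : ℝ => mlW β β (s ^ β)) :=
    (mlW_cont hβ hβ1 hβ).comp (continuous_id.rpow_const fun _ => Or.inr hβ.le)
  let S : Set ℝ := {s | 0 ≤ s ∧ mlW β β (s ^ β) ≤ 0}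
  have hSc : IsClosed S := isClosed_Ici.inter (isClosed_le hWc continuous_const)
  have hSne : S.Nonempty := ⟨t, ht, not_lt.mp hcon⟩
  have hSb : BddBelow S := ⟨0, fun s hs => hs.1⟩
  obtain ⟨t0, ht0S, hlt⟩ : ∃ t0 ∈ S, ∀ s < t0, s ∉ S :=
    ⟨sInf S, hSc.csInf_mem hSne hSb, fun s hs => notMem_of_lt_csInf hs hSb⟩
  have ht0 : 0 < t0 := by
    rcases ht0S.1.eq_or_lt with h | h
    · exfalso
      have h2 := ht0S.2
      rw [← h, zero_rpow hβ.ne', mlW_zero hβ hβ1 hβ] at h2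
      have : 0 < 1 / Gamma β := by positivity
      linarith
    · exact h
  have hW : ∀ s, 0 ≤ s → s < t0 → 0 < mlW β β (s ^ β) := by
    intro s hs hs'
    by_contra hc
    exact hlt s hs' ⟨hs, not_lt.mp hc⟩
  let v : ℝ → ℝ := fun s => s ^ (β - 1) * mlW β β (s ^ β)
  have hv : ∀ s, 0 < s → s < t0 → 0 < v s := fun s hs hs' =>
    mul_pos (rpow_pos_of_pos hs _) (hW s hs.le hs')
  have hv0 : v t0 ≤ 0 := mul_nonpos_of_nonneg_of_nonpos (rpow_nonneg ht0.le _) ht0S.2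
  -- choice of the left end point
  obtain ⟨δ, hδ, hδ1, hδ2⟩ : ∃ δ, 0 < δ ∧ δ ≤ t0 / 2 ∧ δ ^ β ≤ β * Gamma β / 4 := by
    refine ⟨min (t0 / 2) ((β * Gamma β / 4) ^ (1 / β)), by positivity, min_le_left _ _, ?_⟩
    calc _ ≤ ((β * Gamma β / 4) ^ (1 / β)) ^ β :=
          rpow_le_rpow (by positivity) (min_le_right _ _) hβ.le
      _ = β * Gamma β / 4 := by
          rw [← rpow_mul (by positivity), one_div_mul_cancel hβ.ne', rpow_one]
  have hvc : ContinuousOn v (Icc (t0 - δ) t0) := by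
    refine ContinuousOn.mul ?_ hWc.continuousOn
    intro s hs
    have : 0 < s := by linarith [hs.1]
    exact (continuousAt_rpow_const _ _ (Or.inl this.ne')).continuousWithinAt
  obtain ⟨r, hr, hrmax⟩ := isCompact_Icc.exists_isMaxOn ⟨t0 - δ, le_refl _, by linarith⟩ hvc
  have hvr : 0 < v r :=
    lt_of_lt_of_le (hv (t0 - δ) (by linarith) (by linarith)) (hrmax ⟨le_refl _, by linarith⟩)
  have hrlt : r < t0 := by
    rcases hr.2.eq_or_lt with h | h
    · rw [h] at hvr; linarith
    · exact h
  have hr0 : 0 < r := by linarith [hr.1]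
  have hI0 := ml_volterra hβ hβ1 ht0
  have hIr := ml_volterra hβ hβ1 hr0
  have hi0 := mlW_conv_integrable hβ hβ1 hβ hβ ht0
  have hir := mlW_conv_integrable hβ hβ1 hβ hβ hr0
  change ∫ s in Ioo 0 t0, (t0 - s) ^ (β - 1) * v s = t0 ^ (β - 1) - Gamma β * v t0 at hI0
  change ∫ s in Ioo 0 r, (r - s) ^ (β - 1) * v s = r ^ (β - 1) - Gamma β * v r at hIr
  change IntegrableOn (fun s => (t0 - s) ^ (β - 1) * v s) (Ioo 0 t0) at hi0
  change IntegrableOn (fun s => (r - s) ^ (β - 1) * v s) (Ioo 0 r) at hir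
  have hsplit : Ioo 0 t0 = Ioc 0 r ∪ Ioo r t0 := (Ioc_union_Ioo_eq_Ioo hr0.le hrlt).symm
  have hi1 : IntegrableOn (fun s => (t0 - s) ^ (β - 1) * v s) (Ioc 0 r) :=
    hi0.mono_set (by rw [hsplit]; exact subset_union_left)
  have hi2 : IntegrableOn (fun s => (t0 - s) ^ (β - 1) * v s) (Ioo r t0) :=
    hi0.mono_set (by rw [hsplit]; exact subset_union_right)
  rw [hsplit, setIntegral_union (by
    rw [Set.disjoint_left]; intro s h1 h2; exact absurd h1.2 (not_le.mpr h2.1))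
    measurableSet_Ioo hi1 hi2, integral_Ioc_eq_integral_Ioo] at hI0
  have hA : ∫ s in Ioo 0 r, (t0 - s) ^ (β - 1) * v s ≤
      (t0 / r) ^ (β - 1) * (r ^ (β - 1) - Gamma β * v r) := by
    rw [← hIr, ← integral_const_mul]
    refine setIntegral_mono_on (hi1.mono_set Ioo_subset_Ioc_self) (hir.const_mul _)
      measurableSet_Ioo ?_
    intro s hs
    have hvs := hv s hs.1 (hs.2.trans hrlt)
    have h1 : 0 < r - s := by linarith [hs.2]
    rw [← mul_assoc ((t0 / r) ^ (β - 1)), ← mul_rpow (by positivity) h1.le]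
    refine mul_le_mul_of_nonneg_right ?_ hvs.le
    refine rpow_le_rpow_of_nonpos (by positivity) ?_ (by linarith)
    rw [div_mul_eq_mul_div, div_le_iff₀ hr0]
    nlinarith [hs.1]
  have hB : ∫ s in Ioo r t0, (t0 - s) ^ (β - 1) * v s ≤ (t0 - r) ^ β / β * v r := by
    rw [← ml_kernel_int hβ hrlt, ← integral_mul_const]
    refine setIntegral_mono_on hi2 ((ml_kernel_integrable hβ hrlt).mul_const _)
      measurableSet_Ioo ?_
    intro s hs
    have h1 : 0 < t0 - s := by linarith [hs.2]
    exact mul_le_mul_of_nonneg_left (hrmax ⟨by linarith [hs.1, hr.1], hs.2.le⟩)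
      (rpow_nonneg h1.le _)
  have hC : (t0 / r) ^ (β - 1) * r ^ (β - 1) = t0 ^ (β - 1) := by
    rw [← mul_rpow (by positivity) hr0.le, div_mul_cancel₀ _ hr0.ne']
  have hD : (1 / 2 : ℝ) ≤ (t0 / r) ^ (β - 1) := by
    calc (1 / 2 : ℝ) = 2 ^ (-1 : ℝ) := by rw [rpow_neg_one]; norm_num
      _ ≤ 2 ^ (β - 1) := rpow_le_rpow_of_exponent_le (by norm_num) (by linarith)
      _ ≤ _ := by
        refine rpow_le_rpow_of_nonpos (by positivity) ?_ (by linarith)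
        rw [div_le_iff₀ hr0]; linarith [hr.1]
  have hE : (t0 - r) ^ β / β ≤ Gamma β / 4 := by
    rw [div_le_iff₀ hβ]
    have : (t0 - r) ^ β ≤ δ ^ β := rpow_le_rpow (by linarith) (by linarith [hr.1]) hβ.le
    linarith
  have h1 := mul_le_mul_of_nonneg_right hE hvr.le
  have h2 := mul_le_mul_of_nonneg_right hD (mul_pos hG hvr).le
  have h3 : Gamma β * v t0 ≤ 0 := mul_nonpos_of_nonneg_of_nonpos hG.le hv0
  have h4 : 0 < Gamma β * v r := mul_pos hG hvr
  rw [mul_sub, hC] at hA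
  linarith

theorem mittagLeffler_two_sided_bound (β x : ℝ) (hβ : 0 < β) (hβ1 : β < 1) (hx : 0 < x) :
    1 / (1 + Real.Gamma (1 - β) * x) ≤ mittagLeffler β (-x) ∧
      mittagLeffler β (-x) ≤ 1 / (1 + x / Real.Gamma (1 + β)) := by
  obtain ⟨t, ht, rfl⟩ : ∃ t : ℝ, 0 < t ∧ t ^ β = x :=
    ⟨x ^ (1 / β), by positivity, by
      rw [← rpow_mul hx.le, one_div_mul_cancel hβ.ne', rpow_one]⟩
  change _ ≤ mlW β 1 (t ^ β) ∧ mlW β 1 (t ^ β) ≤ _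
  let v : ℝ → ℝ := fun s => s ^ (β - 1) * mlW β β (s ^ β)
  have hv : ∀ s, 0 < s → 0 ≤ v s := fun s hs =>
    mul_nonneg (rpow_nonneg hs.le _) (mlW_pos hβ hβ1 hs.le).le
  have hvi : ∀ s, 0 < s → IntegrableOn v (Ioo 0 s) := by
    intro s hs
    have := mlW_conv_integrable hβ hβ1 one_pos hβ hs
    simpa only [sub_self, rpow_zero, one_mul] using this
  have hu : ∀ s, 0 < s → ∫ r in Ioo 0 s, v r = 1 - mlW β 1 (s ^ β) := by
    intro s hs
    have := mlW_conv hβ hβ1 one_pos hβ hs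
    simp only [sub_self, rpow_zero, one_mul, Gamma_one, add_sub_cancel_left] at this
    rw [mlW_rec hβ hβ1 one_pos (s ^ β), Gamma_one]
    simp only [v]
    rw [this]; ring
  have hanti : ∀ s, 0 < s → s ≤ t → mlW β 1 (t ^ β) ≤ mlW β 1 (s ^ β) := by
    intro s hs hst
    have h : ∫ r in Ioo 0 s, v r ≤ ∫ r in Ioo 0 t, v r := by
      refine setIntegral_mono_set (hvi t ht) ?_ (Ioo_subset_Ioo_right hst).eventuallyLE
      filter_upwards [ae_restrict_mem measurableSet_Ioo] with r hr
      exact hv r hr.1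
    rw [hu s hs, hu t ht] at h
    linarith
  have hx := rpow_pos_of_pos ht β
  have hG := Gamma_pos_of_pos hβ
  have hG1 : 0 < Gamma (1 - β) := Gamma_pos_of_pos (by linarith)
  have hGb : Gamma (1 + β) = β * Gamma β := by rw [add_comm, Gamma_add_one hβ.ne']
  constructor
  · have h4 := mlW_conv hβ hβ1 (by linarith : 0 < 1 - β) hβ ht
    have hi4 := mlW_conv_integrable hβ hβ1 (by linarith : 0 < 1 - β) hβ ht
    rw [sub_add_cancel, sub_self, rpow_zero, one_mul] at h4
    have h5 : t ^ (1 - β - 1) * (1 - mlW β 1 (t ^ β)) ≤ Gamma (1 - β) * mlW β 1 (t ^ β) := by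
      rw [← h4, ← hu t ht, ← integral_const_mul]
      refine setIntegral_mono_on ((hvi t ht).const_mul _) hi4 measurableSet_Ioo ?_
      intro s hs
      refine mul_le_mul_of_nonneg_right ?_ (hv s hs.1)
      exact rpow_le_rpow_of_nonpos (by linarith [hs.2]) (by linarith [hs.1]) (by linarith)
    rw [show (1 - β - 1) = -β by ring, rpow_neg ht.le, inv_mul_le_iff₀ hx] at h5
    rw [div_le_iff₀ (by positivity)]
    linarith
  · have h3 := mlW_conv hβ hβ1 hβ one_pos ht
    have hi3 := mlW_conv_integrable hβ hβ1 hβ one_pos ht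
    simp only [sub_self, rpow_zero, one_mul, add_sub_cancel_right] at h3 hi3
    have h5 : t ^ β / β * mlW β 1 (t ^ β) ≤ Gamma β * (1 - mlW β 1 (t ^ β)) := by
      have e : Gamma β * (1 - mlW β 1 (t ^ β)) = Gamma β * (t ^ β * mlW β (β + 1) (t ^ β)) := by
        rw [mlW_rec hβ hβ1 one_pos (t ^ β), Gamma_one, add_comm β 1]; ring
      have e2 := ml_kernel_int hβ ht
      rw [sub_zero] at e2
      rw [e, ← h3, ← e2, ← integral_mul_const]
      refine setIntegral_mono_on ((ml_kernel_integrable hβ ht).mul_const _) hi3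
        measurableSet_Ioo ?_
      intro s hs
      exact mul_le_mul_of_nonneg_left (hanti s hs.1 hs.2.le)
        (rpow_nonneg (by linarith [hs.2]) _)
    rw [hGb, le_div_iff₀ (by positivity)]
    have h6 : t ^ β / (β * Gamma β) * mlW β 1 (t ^ β) ≤ 1 - mlW β 1 (t ^ β) := by
      have : t ^ β / (β * Gamma β) * mlW β 1 (t ^ β) =
          (t ^ β / β * mlW β 1 (t ^ β)) / Gamma β := by field_simp
      rw [this, div_le_iff₀ hG]
      linarith
    linarith
end

section
/- Suppose d ≥ 1 is an integer, α > 0, γ ≥ 0 with d < 2(α+γ), β ∈ (0,1), ν > 0, and t > 0. Then ∫_0^∞ r^(d-1) (E_β(-ν t^β r^α (1+r^2)^(γ/2)))^2 dr ≤ (1/(α+γ)) (Γ(1+β)/ν)^(d/(α+γ)) t^(-βd/(α+γ)) B(d/(α+γ), 2 - d/(α+γ)). -/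
open MeasureTheory Real

noncomputable def betaFn (p q : ℝ) : ℝ :=
  Real.Gamma p * Real.Gamma q / Real.Gamma (p + q)
open Filter Topology

/-- coefficient of `z^n` in `(1-z)^(-a)` -/
noncomputable def cc (a : ℝ) (n : ℕ) : ℝ := ∏ k ∈ Finset.range n, ((a + k) / (k + 1))

lemma cc_zero (a : ℝ) : cc a 0 = 1 := by simp [cc]

lemma cc_succ (a : ℝ) (n : ℕ) : cc a (n + 1) = cc a n * ((a + n) / (n + 1)) := by
  rw [cc, Finset.prod_range_succ, cc]

lemma cc_one (n : ℕ) : cc 1 n = 1 := by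
  induction n with
  | zero => exact cc_zero 1
  | succ n ih =>
    rw [cc_succ, ih, one_mul, add_comm (1 : ℝ), div_self]
    positivity

lemma cc_zero_left (n : ℕ) : cc 0 (n + 1) = 0 := by
  induction n with
  | zero => simp [cc]
  | succ n ih => rw [cc_succ, ih, zero_mul]

lemma cc_nonneg {a : ℝ} (ha : 0 ≤ a) (n : ℕ) : 0 ≤ cc a n := by
  unfold cc
  exact Finset.prod_nonneg fun k _ => by positivity

lemma cc_pos {a : ℝ} (ha : 0 < a) (n : ℕ) : 0 < cc a n := by
  unfold cc
  exact Finset.prod_pos fun k _ => by positivity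

lemma cc_neg {β : ℝ} (h0 : 0 < β) (h1 : β < 1) (n : ℕ) : cc (-β) (n + 1) ≤ 0 := by
  induction n with
  | zero => simp [cc]; linarith
  | succ n ih =>
    rw [cc_succ]
    refine mul_nonpos_of_nonpos_of_nonneg ih ?_
    have : (0 : ℝ) ≤ n := n.cast_nonneg
    push_cast
    apply div_nonneg <;> linarith

lemma cc_eq_choose (a : ℝ) (n : ℕ) : cc a n = (-1) ^ n * Ring.choose (-a) n := by
  rw [Ring.choose_eq_smul]
  induction n with
  | zero => simp [cc]
  | succ n ih =>
    rw [cc_succ, ih, descPochhammer_succ_right, Polynomial.smeval_mul, Nat.factorial_succ]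
    simp only [smul_eq_mul, Polynomial.smeval_sub, Polynomial.smeval_X, Polynomial.smeval_natCast,
      pow_one, pow_zero]
    push_cast
    have : ((n.factorial : ℕ) : ℝ) ≠ 0 := by positivity
    have : (n : ℝ) + 1 ≠ 0 := by positivity
    field_simp
    simp
    ring

lemma cc_vander (a b : ℝ) (n : ℕ) :
    ∑ p ∈ Finset.HasAntidiagonal.antidiagonal n, cc a p.1 * cc b p.2 = cc (a + b) n := by
  rw [cc_eq_choose, neg_add, Ring.add_choose_eq n (Commute.all _ _), Finset.mul_sum]
  refine Finset.sum_congr rfl fun p hp => ?_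
  rw [← Finset.HasAntidiagonal.mem_antidiagonal.1 hp, cc_eq_choose, cc_eq_choose, pow_add]
  ring

noncomputable def PP (a : ℝ) : PowerSeries ℝ := PowerSeries.mk (cc a)

lemma PP_mul (a b : ℝ) : PP a * PP b = PP (a + b) := by
  ext n
  simp only [PP, PowerSeries.coeff_mul, PowerSeries.coeff_mk, cc_vander]

lemma PP_zero : PP 0 = 1 := by
  ext n
  rcases n with _ | n
  · simp [PP, cc_zero]
  · simp [PP, cc_zero_left, PowerSeries.coeff_one]

/-- positivity of the inverse of `(1-z)^β + ε` applied to nonneg series -/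
lemma pos_of_eq {β ε : ℝ} (h0 : 0 < β) (h1 : β < 1) (hε : 0 ≤ ε) (F Q : PowerSeries ℝ)
    (hQ : ∀ n, 0 ≤ PowerSeries.coeff n Q)
    (h : PP (-β) * F + PowerSeries.C ε * F = Q) (n : ℕ) : 0 ≤ PowerSeries.coeff n F := by
  induction n using Nat.strong_induction_on with
  | _ n ih =>
    have h2 := congrArg (PowerSeries.coeff n) h
    rw [map_add, PowerSeries.coeff_C_mul, PowerSeries.coeff_mul,
      Finset.Nat.sum_antidiagonal_eq_sum_range_succ_mk, Finset.sum_range_succ'] at h2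
    simp only [PP, PowerSeries.coeff_mk, cc_zero, Nat.sub_zero, one_mul] at h2
    have h3 : ∑ k ∈ Finset.range n, cc (-β) (k + 1) * PowerSeries.coeff (n - (k + 1)) F ≤ 0 := by
      refine Finset.sum_nonpos fun k hk => ?_
      have := Finset.mem_range.1 hk
      exact mul_nonpos_of_nonpos_of_nonneg (cc_neg h0 h1 k) (ih _ (by omega))
    have h4 := hQ n
    by_contra h5
    push Not at h5
    nlinarith

lemma discrete_bound {β ε : ℝ} (h0 : 0 < β) (h1 : β < 1) (hε : 0 ≤ ε) (F : PowerSeries ℝ)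
    (h : PP (-β) * F + PowerSeries.C ε * F = PP (1 - β)) (n : ℕ) :
    0 ≤ PowerSeries.coeff n F ∧ PowerSeries.coeff n F * (1 + ε * cc (1 + β) n) ≤ 1 := by
  have hpos := pos_of_eq h0 h1 hε F _ (fun n => by
    simpa [PP] using cc_nonneg (by linarith) n) h
  refine ⟨hpos n, ?_⟩
  have hH := pos_of_eq h0 h1 hε (1 - PP (-1) * F) (PowerSeries.C ε) (fun n => by
    rw [PowerSeries.coeff_C]; split_ifs <;> simp [hε]) (by
    have : PP (-1) * PP (1 - β) = PP (-β) := by rw [PP_mul]; congr 1; ring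
    rw [← h] at this
    linear_combination -this)
  have hanti : Antitone fun n => PowerSeries.coeff n F := by
    refine antitone_nat_of_succ_le fun n => ?_
    have h3 := hH (n + 1)
    rw [map_sub, PowerSeries.coeff_mul,
      Finset.Nat.sum_antidiagonal_eq_sum_range_succ_mk, Finset.sum_range_succ',
      Finset.sum_range_succ'] at h3
    have h4 : ∀ k, cc (-1) (k + 2) = 0 := by
      intro k
      induction k with
      | zero => simp [cc, Finset.prod_range_succ]
      | succ k ih => rw [cc_succ, ih, zero_mul]
    have h5 : cc (-1) 1 = -1 := by simp [cc]
    simp [PP, cc_zero, h4, h5, PowerSeries.coeff_one] at h3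
    linarith
  have h6 : F + PowerSeries.C ε * (PP β * F) = PP 1 := by
    have e1 : PP β * PP (1 - β) = PP 1 := by rw [PP_mul]; congr 1; ring
    have e2 : PP β * PP (-β) = 1 := by rw [PP_mul, add_neg_cancel, PP_zero]
    rw [← h] at e1
    linear_combination e1 - F * e2
  have h7 := congrArg (PowerSeries.coeff n) h6
  rw [map_add, PowerSeries.coeff_C_mul, PowerSeries.coeff_mul] at h7
  simp only [PP, PowerSeries.coeff_mk, cc_one] at h7
  have h8 : PowerSeries.coeff n F * cc (1 + β) n ≤
      ∑ p ∈ Finset.HasAntidiagonal.antidiagonal n, cc β p.1 * PowerSeries.coeff p.2 F := by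
    rw [add_comm 1 β, ← cc_vander, Finset.mul_sum]
    refine Finset.sum_le_sum fun p hp => ?_
    rw [cc_one, mul_one, mul_comm]
    have := Finset.HasAntidiagonal.mem_antidiagonal.1 hp
    exact mul_le_mul_of_nonneg_left (hanti (by omega)) (cc_nonneg h0.le _)
  nlinarith [mul_le_mul_of_nonneg_left h8 hε]

lemma cc_le_pow {m : ℝ} (hm : 0 ≤ m) (n : ℕ) : cc (1 + m) n ≤ (1 + m) ^ n := by
  induction n with
  | zero => simp [cc]
  | succ n ih =>
    rw [cc_succ, pow_succ]
    refine mul_le_mul ih ?_ (by positivity) (by positivity)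
    rw [div_le_iff₀ (by positivity)]
    nlinarith [mul_nonneg hm (n.cast_nonneg (α := ℝ))]

lemma cc_le {m : ℝ} (hm : 0 ≤ m) {N n : ℕ} (hN : 0 < N) (hn : N ≤ n) :
    cc (1 + m) n ≤ (1 + m) ^ N * ((n : ℝ) / N) ^ m := by
  induction n, hn using Nat.le_induction with
  | base =>
    have : (N : ℝ) ≠ 0 := by positivity
    rw [div_self this, one_rpow, mul_one]
    exact cc_le_pow hm N
  | succ n hn ih =>
    have hn0 : (0 : ℝ) < n := by exact_mod_cast (by omega : 0 < n)
    have hN0 : (0 : ℝ) < N := by exact_mod_cast hN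
    have key : (1 + m + n) / (n + 1) ≤ (((n : ℝ) + 1) / n) ^ m := by
      rw [rpow_def_of_pos (by positivity)]
      have h1 : 1 / ((n : ℝ) + 1) ≤ log ((n + 1) / n) := by
        have := Real.one_sub_inv_le_log_of_pos (x := ((n : ℝ) + 1) / n) (by positivity)
        refine le_trans (le_of_eq ?_) this
        field_simp
        ring
      have h2 := Real.add_one_le_exp (log (((n : ℝ) + 1) / n) * m)
      have h3 := mul_le_mul_of_nonneg_right h1 hm
      refine le_trans (le_trans (le_of_eq ?_) (by linarith : 1 / ((n : ℝ) + 1) * m + 1 ≤ _)) h2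
      field_simp
      ring
    rw [cc_succ]
    have e : (((n + 1 : ℕ) : ℝ) / N) ^ m = ((n : ℝ) / N) ^ m * (((n : ℝ) + 1) / n) ^ m := by
      rw [← mul_rpow (by positivity) (by positivity)]
      congr 1
      push_cast
      field_simp
    rw [e, ← mul_assoc]
    exact mul_le_mul ih key (by positivity) (by positivity)

lemma summable_aux {β q : ℝ} (hβ : 0 < β) (hβ1 : β < 1) (hq : 0 ≤ q) (hq1 : q < 1) (N : ℕ) :
    Summable fun j : ℕ => q ^ j * (1 + β * j) ^ N := by
  have h1 := summable_pow_mul_geometric_of_norm_lt_one N (r := q) (by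
    rwa [Real.norm_eq_abs, abs_of_nonneg hq])
  have h2 := (summable_nat_add_iff 1).2 h1
  rcases hq.eq_or_lt with rfl | hq0
  · refine summable_of_ne_finset_zero (s := {0}) fun j hj => ?_
    have : j ≠ 0 := by simpa using hj
    simp [this]
  refine Summable.of_nonneg_of_le (fun j => by positivity) (fun j => ?_) (h2.mul_left q⁻¹)
  have : q⁻¹ * (((j + 1 : ℕ) : ℝ) ^ N * q ^ (j + 1)) = q ^ j * ((j + 1 : ℕ) : ℝ) ^ N := by
    rw [pow_succ]; field_simp
  rw [this]
  refine mul_le_mul_of_nonneg_left ?_ (by positivity)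
  refine pow_le_pow_left₀ (by positivity) ?_ N
  push_cast
  nlinarith [mul_nonneg (sub_nonneg.2 hβ1.le) (j.cast_nonneg (α := ℝ))]

noncomputable def ff (β ε : ℝ) (n : ℕ) : ℝ := ∑' j : ℕ, (-ε) ^ j * cc (1 + β * j) n

lemma ff_summable {β ε : ℝ} (hβ : 0 < β) (hβ1 : β < 1) (hε : 0 ≤ ε) (hε1 : ε < 1) (n : ℕ) :
    Summable fun j : ℕ => (-ε) ^ j * cc (1 + β * j) n := by
  refine Summable.of_norm_bounded (summable_aux hβ hβ1 hε hε1 n) fun j => ?_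
  rw [norm_mul, norm_pow, norm_neg, Real.norm_eq_abs, abs_of_nonneg hε, Real.norm_eq_abs,
    abs_of_nonneg (cc_nonneg (by positivity) _)]
  exact mul_le_mul_of_nonneg_left (cc_le_pow (by positivity) n) (by positivity)

lemma ff_eq {β ε : ℝ} (hβ : 0 < β) (hβ1 : β < 1) (hε : 0 ≤ ε) (hε1 : ε < 1) :
    PP (-β) * PowerSeries.mk (ff β ε) + PowerSeries.C ε * PowerSeries.mk (ff β ε)
      = PP (1 - β) := by
  ext n
  rw [map_add, PowerSeries.coeff_C_mul, PowerSeries.coeff_mul]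
  simp only [PP, PowerSeries.coeff_mk]
  have h1 : HasSum (fun j : ℕ => ∑ p ∈ Finset.HasAntidiagonal.antidiagonal n,
      cc (-β) p.1 * ((-ε) ^ j * cc (1 + β * j) p.2))
      (∑ p ∈ Finset.HasAntidiagonal.antidiagonal n, cc (-β) p.1 * ff β ε p.2) :=
    hasSum_sum fun p _ => ((ff_summable hβ hβ1 hε hε1 p.2).hasSum).mul_left _
  have h2 : ∀ j : ℕ, ∑ p ∈ Finset.HasAntidiagonal.antidiagonal n,
      cc (-β) p.1 * ((-ε) ^ j * cc (1 + β * j) p.2) = (-ε) ^ j * cc (1 - β + β * j) n := by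
    intro j
    rw [show 1 - β + β * (j : ℝ) = -β + (1 + β * j) by ring, ← cc_vander, Finset.mul_sum]
    exact Finset.sum_congr rfl fun p _ => by ring
  simp only [h2] at h1
  have h3 := (hasSum_nat_add_iff' 1).2 h1
  have h4 := ((ff_summable hβ hβ1 hε hε1 n).hasSum).mul_left (-ε)
  have h5 : (fun j : ℕ => -ε * ((-ε) ^ j * cc (1 + β * j) n)) =
      fun j : ℕ => (-ε) ^ (j + 1) * cc (1 - β + β * ((j + 1 : ℕ) : ℝ)) n := by
    funext j
    rw [show 1 - β + β * ((j + 1 : ℕ) : ℝ) = 1 + β * j by push_cast; ring]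
    ring
  rw [h5] at h4
  have h6 := h3.unique h4
  simp at h6
  change _ + ε * ff β ε n = _
  unfold ff at h6 ⊢
  linarith

lemma cc_tendsto {m : ℝ} (hm : 0 ≤ m) :
    Tendsto (fun n : ℕ => cc (1 + m) n / (n : ℝ) ^ m) atTop (𝓝 (1 / Gamma (1 + m))) := by
  have h1 := Real.GammaSeq_tendsto_Gamma (1 + m)
  have h2 := tendsto_natCast_div_add_atTop (𝕜 := ℝ) (1 + m)
  have h3 := h2.div h1 (Gamma_pos_of_pos (by linarith)).ne'
  refine h3.congr' ?_
  filter_upwards [eventually_gt_atTop 0] with n hn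
  have hn0 : (0 : ℝ) < n := by exact_mod_cast hn
  have e : cc (1 + m) n = (∏ j ∈ Finset.range n, (1 + m + j)) / n.factorial := by
    rw [cc, Finset.prod_div_distrib]
    congr 1
    rw [← Finset.prod_range_add_one_eq_factorial]
    push_cast
    rfl
  have hp : (0 : ℝ) < ∏ j ∈ Finset.range n, (1 + m + j) :=
    Finset.prod_pos fun k _ => by positivity
  simp only [Pi.div_apply]
  rw [e, Real.GammaSeq, Finset.prod_range_succ, rpow_add hn0, rpow_one]
  have : (0 : ℝ) < n.factorial := by positivity
  have : (0 : ℝ) < (n : ℝ) ^ m := by positivity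
  have : (0 : ℝ) < (n : ℝ) + (1 + m) := by positivity
  have : (0 : ℝ) < 1 + m + n := by positivity
  field_simp
  ring

lemma ff_tendsto {β x : ℝ} (hβ : 0 < β) (hβ1 : β < 1) (hx : 0 ≤ x) :
    Tendsto (fun n : ℕ => ff β (x / (n : ℝ) ^ β) n) atTop (𝓝 (mittagLeffler β (-x))) := by
  have hlim : Tendsto (fun n : ℕ => x / (n : ℝ) ^ β) atTop (𝓝 0) :=
    ((tendsto_rpow_atTop hβ).comp tendsto_natCast_atTop_atTop).const_div_atTop x
  obtain ⟨N, hN1, hN0⟩ :=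
    ((hlim.eventually (gt_mem_nhds (zero_lt_one))).and (eventually_gt_atTop 0)).exists
  have hN : (0 : ℝ) < N := by exact_mod_cast hN0
  unfold ff mittagLeffler
  refine tendsto_tsum_of_dominated_convergence
    (summable_aux hβ hβ1 (q := x / (N : ℝ) ^ β) (by positivity) hN1 N) ?_ ?_
  · intro j
    have h := (cc_tendsto (m := β * j) (by positivity)).const_mul ((-x) ^ j)
    rw [mul_one_div] at h
    refine h.congr' ?_
    filter_upwards [eventually_gt_atTop 0] with n hn
    have hn0 : (0 : ℝ) < n := by exact_mod_cast hn
    rw [← neg_div, div_pow, rpow_mul_natCast hn0.le]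
    ring
  · filter_upwards [eventually_ge_atTop N] with n hn j
    have hn0 : (0 : ℝ) < n := by exact_mod_cast (by omega : 0 < n)
    rw [norm_mul, norm_pow, norm_neg, Real.norm_eq_abs, abs_of_nonneg (by positivity),
      Real.norm_eq_abs, abs_of_nonneg (cc_nonneg (by positivity) _)]
    have h := cc_le (m := β * j) (by positivity) hN0 hn
    refine (mul_le_mul_of_nonneg_left h (by positivity)).trans (le_of_eq ?_)
    rw [rpow_mul_natCast (by positivity), div_rpow hn0.le hN.le, div_pow, div_pow, div_pow]
    field_simp

lemma ml_bound {β x : ℝ} (hβ : 0 < β) (hβ1 : β < 1) (hx : 0 ≤ x) :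
    0 ≤ mittagLeffler β (-x) ∧ mittagLeffler β (-x) * (1 + x / Gamma (1 + β)) ≤ 1 := by
  have hlim : Tendsto (fun n : ℕ => x / (n : ℝ) ^ β) atTop (𝓝 0) :=
    ((tendsto_rpow_atTop hβ).comp tendsto_natCast_atTop_atTop).const_div_atTop x
  have hev := hlim.eventually (gt_mem_nhds (zero_lt_one))
  have h1 := ff_tendsto hβ hβ1 hx
  have hb : ∀ᶠ n : ℕ in atTop, 0 ≤ ff β (x / (n : ℝ) ^ β) n ∧
      ff β (x / (n : ℝ) ^ β) n * (1 + x * (cc (1 + β) n / (n : ℝ) ^ β)) ≤ 1 := by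
    filter_upwards [hev] with n hn
    have hε : 0 ≤ x / (n : ℝ) ^ β := by positivity
    have := discrete_bound hβ hβ1 hε _ (ff_eq hβ hβ1 hε hn) n
    simp only [PowerSeries.coeff_mk] at this
    rwa [show x * (cc (1 + β) n / (n : ℝ) ^ β) = x / (n : ℝ) ^ β * cc (1 + β) n by ring]
  refine ⟨ge_of_tendsto h1 (hb.mono fun n h => h.1), ?_⟩
  have h2 := h1.mul (((cc_tendsto hβ.le).const_mul x).const_add 1)
  rw [mul_one_div] at h2
  exact le_of_tendsto h2 (hb.mono fun n h => h.2)

lemma lint_aux {p b q : ℝ} (hp : 0 < p) (hq : -1 < q) (hb : 0 < b) :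
    ∫⁻ x in Set.Ioi (0 : ℝ), ENNReal.ofReal (x ^ q * exp (-b * x ^ p)) =
      ENNReal.ofReal (b ^ (-(q + 1) / p) * (1 / p) * Gamma ((q + 1) / p)) := by
  rw [← integral_rpow_mul_exp_neg_mul_rpow hp hq hb, ofReal_integral_eq_lintegral_ofReal]
  · by_contra h
    have h2 := integral_undef h
    rw [integral_rpow_mul_exp_neg_mul_rpow hp hq hb] at h2
    have : 0 < Gamma ((q + 1) / p) := Gamma_pos_of_pos (div_pos (by linarith) hp)
    have : 0 < b ^ (-(q + 1) / p) * (1 / p) * Gamma ((q + 1) / p) := by positivity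
    linarith
  · filter_upwards [self_mem_ae_restrict measurableSet_Ioi] with x hx
    have : (0 : ℝ) < x := hx
    simp only [Pi.zero_apply]
    positivity

lemma beta_lint {D s c : ℝ} (hD : 0 < D) (hs : 0 < s) (hDs : D < 2 * s) (hc : 0 < c) :
    ∫⁻ r in Set.Ioi (0 : ℝ), ENNReal.ofReal (r ^ (D - 1) * (1 / (1 + c * r ^ s)) ^ 2) =
      ENNReal.ofReal ((1 / s) * c ^ (-(D / s)) * betaFn (D / s) (2 - D / s)) := by
  have hDs2 : D / s < 2 := by rw [div_lt_iff₀ hs]; exact hDs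
  have hG : 0 < Gamma (D / s) := Gamma_pos_of_pos (by positivity)
  have e1 : ∀ r ∈ Set.Ioi (0 : ℝ), ENNReal.ofReal (r ^ (D - 1) * (1 / (1 + c * r ^ s)) ^ 2) =
      ∫⁻ y in Set.Ioi (0 : ℝ),
        ENNReal.ofReal (r ^ (D - 1) * (y * exp (-(1 + c * r ^ s) * y))) := by
    intro r hr
    have hr0 : (0 : ℝ) < r := hr
    have hb : 0 < 1 + c * r ^ s := by positivity
    have h := lint_aux (p := 1) (q := 1) (b := 1 + c * r ^ s) one_pos (by norm_num) hb
    simp only [rpow_one] at h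
    simp only [ENNReal.ofReal_mul (show 0 ≤ r ^ (D - 1) by positivity)]
    rw [lintegral_const_mul _ (by fun_prop), h]
    congr 2
    norm_num [Real.rpow_neg hb.le]
  rw [setLIntegral_congr_fun measurableSet_Ioi e1, lintegral_lintegral_swap (by fun_prop)]
  have e2 : ∀ y ∈ Set.Ioi (0 : ℝ), ∫⁻ r in Set.Ioi (0 : ℝ),
        ENNReal.ofReal (r ^ (D - 1) * (y * exp (-(1 + c * r ^ s) * y))) =
      ENNReal.ofReal (c ^ (-(D / s)) * (1 / s) * Gamma (D / s)) *
        ENNReal.ofReal (y ^ (1 - D / s) * exp (-1 * y ^ (1 : ℝ))) := by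
    intro y hy
    have hy0 : (0 : ℝ) < y := hy
    have h := lint_aux (p := s) (q := D - 1) (b := c * y) hs (by linarith) (by positivity)
    have e3 : ∀ r : ℝ, ENNReal.ofReal (r ^ (D - 1) * (y * exp (-(1 + c * r ^ s) * y))) =
        ENNReal.ofReal (y * exp (-y)) *
          ENNReal.ofReal (r ^ (D - 1) * exp (-(c * y) * r ^ s)) := by
      intro r
      rw [← ENNReal.ofReal_mul (by positivity),
        show -(1 + c * r ^ s) * y = -y + -(c * y) * r ^ s by ring, exp_add]
      congr 1
      ring
    simp only [e3]
    rw [lintegral_const_mul _ (by fun_prop), h, ← ENNReal.ofReal_mul (by positivity),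
      ← ENNReal.ofReal_mul (by positivity)]
    congr 1
    rw [sub_add_cancel, neg_div, mul_rpow hc.le hy0.le, sub_eq_add_neg, rpow_add hy0, rpow_one,
      neg_one_mul]
    ring
  rw [setLIntegral_congr_fun measurableSet_Ioi e2, lintegral_const_mul _ (by fun_prop),
    lint_aux one_pos (by linarith) one_pos, ← ENNReal.ofReal_mul (by positivity)]
  congr 1
  rw [betaFn, show D / s + (2 - D / s) = 2 by ring, Real.Gamma_two, one_rpow,
    show (1 - D / s + 1) / 1 = 2 - D / s by ring]
  ring

theorem radial_green_square_bound (d : ℕ) (hd : 1 ≤ d) (α γ β ν t : ℝ)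
    (hα : 0 < α) (hγ : 0 ≤ γ) (hdim : (d : ℝ) < 2 * (α + γ))
    (hβ : 0 < β) (hβ1 : β < 1) (hν : 0 < ν) (ht : 0 < t) :
    ∫ r in Set.Ioi (0 : ℝ),
        r ^ ((d : ℝ) - 1) * (mittagLeffler β (-(ν * t ^ β * r ^ α * (1 + r ^ 2) ^ (γ / 2)))) ^ 2
      ≤ (1 / (α + γ)) * (Real.Gamma (1 + β) / ν) ^ ((d : ℝ) / (α + γ))
          * t ^ (-(β * d / (α + γ)))
          * betaFn ((d : ℝ) / (α + γ)) (2 - (d : ℝ) / (α + γ)) := by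
  have hD : (0 : ℝ) < d := by exact_mod_cast hd
  have hs : 0 < α + γ := by linarith
  have hG : 0 < Gamma (1 + β) := Gamma_pos_of_pos (by linarith)
  set c : ℝ := ν * t ^ β / Gamma (1 + β) with hcdef
  have hc : 0 < c := by positivity
  have hL := beta_lint hD hs hdim hc
  have hDs2 : (d : ℝ) / (α + γ) < 2 := by rw [div_lt_iff₀ hs]; exact hdim
  have hB : 0 ≤ betaFn ((d : ℝ) / (α + γ)) (2 - (d : ℝ) / (α + γ)) := by
    have h1 : 0 < Gamma ((d : ℝ) / (α + γ)) := Gamma_pos_of_pos (by positivity)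
    have h2 : 0 < Gamma (2 - (d : ℝ) / (α + γ)) := Gamma_pos_of_pos (by linarith)
    rw [betaFn, add_sub_cancel, Real.Gamma_two]
    positivity
  have hg0 : 0 ≤ᵐ[volume.restrict (Set.Ioi (0 : ℝ))]
      fun r : ℝ => r ^ ((d : ℝ) - 1) * (1 / (1 + c * r ^ (α + γ))) ^ 2 := by
    filter_upwards [self_mem_ae_restrict measurableSet_Ioi] with r hr
    have : (0 : ℝ) < r := hr
    simp only [Pi.zero_apply]
    positivity
  have hgm : AEStronglyMeasurable
      (fun r : ℝ => r ^ ((d : ℝ) - 1) * (1 / (1 + c * r ^ (α + γ))) ^ 2)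
      (volume.restrict (Set.Ioi (0 : ℝ))) := by
    apply Measurable.aestronglyMeasurable
    fun_prop
  have hgi : Integrable (fun r : ℝ => r ^ ((d : ℝ) - 1) * (1 / (1 + c * r ^ (α + γ))) ^ 2)
      (volume.restrict (Set.Ioi (0 : ℝ))) := by
    rw [← lintegral_ofReal_ne_top_iff_integrable hgm hg0, hL]
    exact ENNReal.ofReal_ne_top
  have hval : ∫ r in Set.Ioi (0 : ℝ), r ^ ((d : ℝ) - 1) * (1 / (1 + c * r ^ (α + γ))) ^ 2 =
      (1 / (α + γ)) * c ^ (-((d : ℝ) / (α + γ)))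
        * betaFn ((d : ℝ) / (α + γ)) (2 - (d : ℝ) / (α + γ)) := by
    rw [integral_eq_lintegral_of_nonneg_ae hg0 hgm, hL, ENNReal.toReal_ofReal (by positivity)]
  have hcc : c ^ (-((d : ℝ) / (α + γ))) =
      (Real.Gamma (1 + β) / ν) ^ ((d : ℝ) / (α + γ)) * t ^ (-(β * d / (α + γ))) := by
    rw [rpow_neg hc.le, ← inv_rpow hc.le,
      show c⁻¹ = Gamma (1 + β) / ν * (t ^ (-β)) by
        rw [hcdef, rpow_neg ht.le]; field_simp,
      mul_rpow (by positivity) (by positivity), ← rpow_mul ht.le]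
    congr 2
    ring
  rw [hcc, ← mul_assoc (1 / (α + γ))] at hval
  rw [← hval]
  refine integral_mono_of_nonneg ?_ hgi ?_
  · filter_upwards [self_mem_ae_restrict measurableSet_Ioi] with r hr
    have : (0 : ℝ) < r := hr
    simp only [Pi.zero_apply]
    positivity
  · filter_upwards [self_mem_ae_restrict measurableSet_Ioi] with r hr
    have hr0 : (0 : ℝ) < r := hr
    refine mul_le_mul_of_nonneg_left ?_ (by positivity)
    obtain ⟨h1, h2⟩ := ml_bound (x := ν * t ^ β * r ^ α * (1 + r ^ 2) ^ (γ / 2)) hβ hβ1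
      (by positivity)
    refine pow_le_pow_left₀ h1 ?_ 2
    rw [le_div_iff₀ (by positivity)]
    refine le_trans (mul_le_mul_of_nonneg_left ?_ h1) h2
    have h3 : r ^ γ ≤ (1 + r ^ 2) ^ (γ / 2) := by
      have : r ^ γ = (r ^ 2) ^ (γ / 2) := by
        rw [← rpow_natCast, ← rpow_mul hr0.le]
        congr 1
        push_cast
        ring
      rw [this]
      exact rpow_le_rpow (by positivity) (by linarith) (by positivity)
    rw [hcdef, rpow_add hr0, div_mul_eq_mul_div, add_le_add_iff_left, ← mul_assoc]
    gcongr
end
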